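/- arXiv:2007.14192 — 2 statements merged into one kernel-verified Lean document; each statement's English description precedes it below -/
import Mathlib

section
/- A graph G is weakly modular if and only if every metric triangle of G is strongly equilateral, i.e., for every metric triangle u1u2u3 and every vertex x in the interval I(u1,u2), one has d_G(u3,x) = d_G(u1,u2). -/
open SimpleGraph

variable {V : Type*}

/-- The metric interval between `u` and `v`. -/
def interval (G : SimpleGraph V) (u v : V) : Set V :=
  {w | G.dist u w + G.dist w v = G.dist u v}

/-- Triangle condition (TC). -/
def TriangleCondition (G : SimpleGraph V) : Prop :=
  ∀ (k : ℕ) (u v w : V), G.dist u v = k + 1 → G.dist u w = k + 1 → G.Adj v w →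
    ∃ x, G.dist u x = k ∧ G.Adj x v ∧ G.Adj x w

/-- Quadrangle condition (QC). -/
def QuadrangleCondition (G : SimpleGraph V) : Prop :=
  ∀ (k : ℕ) (u v w z : V), G.dist u v = k + 1 → G.dist u w = k + 1 →
    G.dist u z = k + 2 → G.Adj v z → G.Adj w z →
    ∃ x, G.dist u x = k ∧ G.Adj x v ∧ G.Adj x w

def WeaklyModular (G : SimpleGraph V) : Prop :=
  TriangleCondition G ∧ QuadrangleCondition G

/-- No induced 4-cycle. -/
def NoInducedC4 (G : SimpleGraph V) : Prop :=
  ¬ ∃ a b c d : V, G.Adj a b ∧ G.Adj b c ∧ G.Adj c d ∧ G.Adj d a ∧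
    a ≠ c ∧ b ≠ d ∧ ¬ G.Adj a c ∧ ¬ G.Adj b d

/-- No induced 5-cycle. -/
def NoInducedC5 (G : SimpleGraph V) : Prop :=
  ¬ ∃ a b c d e : V, G.Adj a b ∧ G.Adj b c ∧ G.Adj c d ∧ G.Adj d e ∧ G.Adj e a ∧
    a ≠ c ∧ a ≠ d ∧ b ≠ d ∧ b ≠ e ∧ c ≠ e ∧
    ¬ G.Adj a c ∧ ¬ G.Adj a d ∧ ¬ G.Adj b d ∧ ¬ G.Adj b e ∧ ¬ G.Adj c e

/-- Bridged graph: weakly modular with no induced `C₄` or `C₅`. -/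
def Bridged (G : SimpleGraph V) : Prop :=
  WeaklyModular G ∧ NoInducedC4 G ∧ NoInducedC5 G

/-- No clique on four vertices. -/
def K4Free (G : SimpleGraph V) : Prop :=
  ¬ ∃ a b c d : V, G.Adj a b ∧ G.Adj a c ∧ G.Adj a d ∧ G.Adj b c ∧ G.Adj b d ∧ G.Adj c d

/-- Closed neighborhood `N[z]`. -/
def closedNbhd (G : SimpleGraph V) (z : V) : Set V := insert z (G.neighborSet z)

/-- Metric projection of `u` on a set `A`. -/
def mproj (G : SimpleGraph V) (u : V) (A : Set V) : Set V :=
  {a ∈ A | ∀ b ∈ A, G.dist u a ≤ G.dist u b}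

/-- The star `St(z)`: `N[z]` together with all vertices outside `N[z]` having two
adjacent neighbors in `N[z]`. -/
def starSet (G : SimpleGraph V) (z : V) : Set V :=
  closedNbhd G z ∪
    {u | u ∉ closedNbhd G z ∧ ∃ y y', G.Adj y y' ∧ G.Adj z y ∧ G.Adj z y' ∧ G.Adj u y ∧ G.Adj u y'}

/-- The panel of a neighbor `x` of `z`: vertices with unique projection `x` on `N[z]`. -/
def panelFiber (G : SimpleGraph V) (z x : V) : Set V :=
  {u | mproj G u (closedNbhd G z) = {x}}

/-- The cone of a vertex `x` at distance 2 from `z` in `St(z)`. -/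
def coneFiber (G : SimpleGraph V) (z x : V) : Set V :=
  {u | ∃ y y', y ≠ y' ∧ G.Adj y y' ∧ G.Adj z y ∧ G.Adj z y' ∧ G.Adj x y ∧ G.Adj x y' ∧
    mproj G u (closedNbhd G z) = {y, y'} ∧ G.dist u x + 1 = G.dist u y}

/-- The fiber of `x ∈ St(z)`: a panel if `x ~ z`, a cone otherwise. -/
def fiberSet (G : SimpleGraph V) (z x : V) : Set V :=
  {u | (G.Adj x z ∧ u ∈ panelFiber G z x) ∨ (¬ G.Adj x z ∧ u ∈ coneFiber G z x)}

/-- Total boundary of a fiber `F`: the vertices of `F` with a neighbor outside `F`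
(i.e. in another fiber of the partition). -/
def totalBoundary (G : SimpleGraph V) (F : Set V) : Set V :=
  {u ∈ F | ∃ v, G.Adj u v ∧ v ∉ F}

/-- `S` is starshaped with respect to `x`. -/
def StarshapedWrt (G : SimpleGraph V) (x : V) (S : Set V) : Prop :=
  ∀ s ∈ S, interval G x s ⊆ S

/-- `S` is a starshaped tree rooted at `x`: intervals to the root are contained in `S`
and each non-root vertex has a unique neighbor towards the root. -/
def StarshapedTree (G : SimpleGraph V) (x : V) (S : Set V) : Prop :=
  x ∈ S ∧ (∀ s ∈ S, interval G x s ⊆ S) ∧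
    (∀ s ∈ S, s ≠ x → ∃! w, w ∈ interval G s x ∧ G.Adj s w)

/-- The tree obtained as the union of the branches of a starshaped tree `S` rooted
at `x`: its edges are the edges of `G` lying consecutively on some branch. -/
def branchTree (G : SimpleGraph V) (x : V) (S : Set V) : SimpleGraph V :=
  SimpleGraph.fromRel (fun u v => G.Adj u v ∧ u ∈ S ∧ v ∈ S ∧
    ∃ s ∈ S, u ∈ interval G x s ∧ v ∈ interval G x s ∧ G.dist x v = G.dist x u + 1)

/-- Metric triangle. -/
def MetricTriangle (G : SimpleGraph V) (u1 u2 u3 : V) : Prop :=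
  interval G u1 u2 ∩ interval G u2 u3 = {u2} ∧
  interval G u2 u3 ∩ interval G u3 u1 = {u3} ∧
  interval G u3 u1 ∩ interval G u1 u2 = {u1}

namespace SimpleGraph.Connected

variable {G : SimpleGraph V}

theorem dist_step (hc : G.Connected) {x y : V} (h : G.Adj x y) (u : V) :
    G.dist u x ≤ G.dist u y + 1 ∧ G.dist u y ≤ G.dist u x + 1 := by
  have h1 : G.dist x y = 1 := dist_eq_one_iff_adj.mpr h
  have h2 := hc.dist_triangle (u := u) (v := x) (w := y)
  have h3 := hc.dist_triangle (u := u) (v := y) (w := x)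
  rw [G.dist_comm (u := y)] at h3
  omega

/-- A vertex at positive distance from `v` has a neighbor one step closer to `v`. -/
theorem exists_adj_dist_succ (hc : G.Connected) {v x : V} {n : ℕ} (h : G.dist v x = n + 1) :
    ∃ t, G.Adj t x ∧ G.dist v t = n := by
  obtain ⟨p, hp⟩ := hc.exists_walk_length_eq_dist x v
  rw [G.dist_comm (u := x), h] at hp
  cases p with
  | nil => simp at hp
  | @cons _ t _ hadj q =>
    refine ⟨t, hadj.symm, ?_⟩
    have h1 : G.dist t v ≤ q.length := dist_le q
    rw [G.dist_comm (u := t)] at h1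
    have h2 := hc.dist_step hadj v
    simp only [Walk.length_cons] at hp
    omega

/-- A vertex preceding a vertex of `I(v, w)` on a geodesic from `v` lies in `I(v, w)`. -/
theorem mem_interval_of_adj (hc : G.Connected) {v w a z : V} (h : G.Adj a z)
    (hd : G.dist v z = G.dist v a + 1) (hz : z ∈ interval G v w) : a ∈ interval G v w := by
  have hz' : G.dist v z + G.dist z w = G.dist v w := hz
  change G.dist v a + G.dist a w = G.dist v w
  have h1 := hc.dist_triangle (u := v) (v := a) (w := w)
  have h2 := hc.dist_step h w
  rw [G.dist_comm (u := w), G.dist_comm (u := w)] at h2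
  omega

end SimpleGraph.Connected

namespace WeaklyModular

variable {G : SimpleGraph V}

/-- If `I(v, u)` and `I(v, w)` share no neighbor of `v`, then the distance to `u` does not
decrease along geodesics from `v` to `w`. -/
theorem dist_le_dist_of_adj (hc : G.Connected) (hG : WeaklyModular G) {u v w : V}
    (H : ∀ p ∈ interval G v w, G.Adj v p → G.dist u v ≤ G.dist u p) {x y : V}
    (hxy : G.Adj x y) (hd : G.dist v y = G.dist v x + 1) (hy : y ∈ interval G v w) :
    G.dist u x ≤ G.dist u y := by
  obtain ⟨TC, QC⟩ := hG
  induction hn : G.dist v x using Nat.strong_induction_on generalizing x y with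
  | _ n ih =>
  have mono : ∀ {a z : V}, G.Adj a z → G.dist v z = G.dist v a + 1 → z ∈ interval G v w →
      G.dist v a < n → G.dist u a ≤ G.dist u z := fun h h1 h2 h3 => ih _ h3 h h1 h2 rfl
  have down := fun {a z : V} => hc.mem_interval_of_adj (v := v) (w := w) (a := a) (z := z)
  have zero : ∀ {a : V}, G.dist v a = 0 → v = a := fun h => hc.dist_eq_zero_iff.mp h
  by_contra hlt
  rcases n with _ | m
  · obtain rfl := zero hn
    exact hlt (H y hy hxy)
  obtain ⟨k, hk⟩ : ∃ k, G.dist u y = k := ⟨_, rfl⟩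
  have hK : G.dist u x = k + 1 := by have := hc.dist_step hxy u; omega
  -- No predecessor of a neighbor `p` of `y` in the interval may be strictly closer to `u`.
  have valley : ∀ {s p : V}, G.Adj s p → G.Adj p y → G.dist v s = m → G.dist v p = m + 1 →
      G.dist u p = k + 1 → G.dist u s = k → False := by
    intro s p hsp hpy hs hp hup hus
    rcases k with _ | j
    · obtain rfl := hc.dist_eq_zero_iff.mp hus
      obtain rfl := hc.dist_eq_zero_iff.mp hk
      omega
    obtain ⟨q, hq, hqs, hqy⟩ := QC j u s y p hus hk hup hsp hpy.symm
    have h1 := hc.dist_step hqs v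
    have h2 := hc.dist_step hqy v
    have hqi := down hqy (by omega) hy
    have := mono hqs.symm (by omega) hqi (by omega)
    omega
  have hx := down hxy hd hy
  obtain ⟨t, htx, ht⟩ := hc.exists_adj_dist_succ hn
  have htI := down htx (by omega) hx
  have hft : G.dist u t = k + 1 := by
    have h1 := mono htx (by omega) hx (by omega)
    have h2 := hc.dist_step htx u
    have h3 : G.dist u t ≠ k := fun h => valley htx hxy ht hn hK h
    omega
  obtain ⟨x', hx', hx't, hx'x⟩ := TC k u t x hft hK htx
  have hvx' : G.dist v x' = m + 1 := by
    have h1 := hc.dist_step hx't v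
    have h2 := hc.dist_step hx'x v
    have h3 : G.dist v x' ≠ m := fun h => valley hx'x hxy h hn hK hx'
    omega
  have hx'y : ¬ G.Adj x' y := fun h => by
    have := mono hx't.symm (by omega) (down h (by omega) hy) (by omega)
    omega
  rcases k with _ | j
  · obtain rfl := hc.dist_eq_zero_iff.mp hx'
    obtain rfl := hc.dist_eq_zero_iff.mp hk
    omega
  obtain ⟨z, hz, hzx', hzy⟩ := QC j u x' y x hx' hk hK hx'x hxy.symm
  have hz1 := hc.dist_step hzx' v
  have hz2 := hc.dist_step hzy v
  have common : ∀ {a : V}, G.Adj a x' → G.dist v a = m → G.dist u a ≤ j + 1 →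
      a ∈ interval G v w → ∃ b, G.dist v b + 1 = m ∧ G.Adj b a ∧ G.Adj b t ∧
        G.dist u b ≤ G.dist u a := by
    intro a hax' ha hua haI
    rcases m with _ | i
    · obtain rfl := zero ha
      obtain rfl := zero ht
      omega
    obtain ⟨b, hb, hba, hbt⟩ := QC i v a t x' ha ht hvx' hax' hx't.symm
    exact ⟨b, by omega, hba, hbt, mono hba (by omega) haI (by omega)⟩
  obtain hvz | hvz : G.dist v z = m + 1 ∨ G.dist v z = m + 2 := by omega
  · obtain ⟨a, ha, hax', haz⟩ := TC m v x' z hvx' hvz hzx'.symm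
    have hzI := down hzy (by omega) hy
    have h1 := mono haz (by omega) hzI (by omega)
    obtain ⟨b, hb, hba, hbt, hle⟩ := common hax' ha (by omega) (down haz (by omega) hzI)
    have := hc.dist_step hbt u
    omega
  · obtain ⟨c, hcd, hcz, hcy⟩ := TC (m + 1) v z y hvz (by omega) hzy
    obtain ⟨e, he, hec, hex'⟩ := QC m v c x' z hcd hvx' hvz hcz hzx'.symm
    have hcI := down hcy (by omega) hy
    have h1 := mono hec (by omega) hcI (by omega)
    have h2 := hc.dist_step hcz u
    obtain ⟨b, hb, hbe, hbt, hle⟩ := common hex' he (by omega) (down hec (by omega) hcI)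
    have h3 := hc.dist_step hbt u
    have two : ∀ {a p : V}, G.Adj a p → G.Adj p y → G.dist v a = m → G.dist y a = 2 := by
      intro a p hap hpy ha
      have h4 := hc.dist_step hap y
      have h5 : G.dist y p = 1 := dist_eq_one_iff_adj.mpr hpy.symm
      have h6 := hc.dist_triangle (u := v) (v := a) (w := y)
      rw [G.dist_comm (u := a)] at h6
      omega
    have hye := two hec hcy he
    have hyt := two htx hxy ht
    have hyb : G.dist y b = 3 := by
      have h4 := hc.dist_step hbt y
      have h6 := hc.dist_triangle (u := v) (v := b) (w := y)
      rw [G.dist_comm (u := b)] at h6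
      omega
    obtain ⟨q, hyq, hqe, hqt⟩ := QC 1 y e t b hye hyt hyb hbe.symm hbt.symm
    have hqy : G.Adj q y := (dist_eq_one_iff_adj.mp hyq).symm
    have h4 := hc.dist_step hqt v
    have h5 := hc.dist_step hqy v
    have h6 := hc.dist_step hqy u
    have h7 := mono hqt.symm (by omega) (down hqy (by omega) hy) (by omega)
    exact valley hqe.symm hqy he (by omega) (by omega) (by omega)

/-- If `I(v, w) ∩ I(v, u) = {v}`, the last vertex of a geodesic from `v` to `w` is farthest
from `u`. -/
theorem dist_le_dist_of_mem_interval (hc : G.Connected) (hG : WeaklyModular G) {u v w x y : V}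
    (H : ∀ p ∈ interval G v w, p ∈ interval G v u → p = v) (hx : x ∈ interval G v y)
    (hy : y ∈ interval G v w) : G.dist u x ≤ G.dist u y := by
  have H' : ∀ p ∈ interval G v w, G.Adj v p → G.dist u v ≤ G.dist u p := by
    intro p hp hvp
    by_contra hlt
    have h1 := hc.dist_step hvp u
    have h2 : G.dist v p = 1 := dist_eq_one_iff_adj.mpr hvp
    refine hvp.ne (H p hp ?_).symm
    change G.dist v p + G.dist p u = G.dist v u
    rw [G.dist_comm (u := p), G.dist_comm (v := u)]
    omega
  have hx' : G.dist v x + G.dist x y = G.dist v y := hx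
  induction hn : G.dist x y generalizing y with
  | zero => rw [hc.dist_eq_zero_iff.mp hn]
  | succ n ih =>
    obtain ⟨t, hty, ht⟩ := hc.exists_adj_dist_succ hn
    have h1 := hc.dist_triangle (u := v) (v := x) (w := t)
    have h2 := hc.dist_step hty v
    have h3 : G.dist v x + G.dist x t = G.dist v t := by omega
    have hd : G.dist v y = G.dist v t + 1 := by omega
    exact (ih h3 (hc.mem_interval_of_adj hty hd hy) h3 ht).trans
      (hG.dist_le_dist_of_adj hc H' hty hd hy)

end WeaklyModular

theorem mem_interval_comm {G : SimpleGraph V} {u v x : V} :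
    x ∈ interval G u v ↔ x ∈ interval G v u := by
  change G.dist u x + G.dist x v = G.dist u v ↔ G.dist v x + G.dist x u = G.dist v u
  rw [G.dist_comm (u := u) (v := x), G.dist_comm (u := x) (v := v),
    G.dist_comm (u := u) (v := v), add_comm]

theorem left_mem_interval {G : SimpleGraph V} {u v : V} : u ∈ interval G u v := by
  simp [interval]

theorem MetricTriangle.rotate {G : SimpleGraph V} {a b c : V} (h : MetricTriangle G a b c) :
    MetricTriangle G b c a :=
  ⟨h.2.1, h.2.2, h.1⟩

theorem WeaklyModular.dist_eq_dist_of_metricTriangle {G : SimpleGraph V} (hc : G.Connected)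
    (hG : WeaklyModular G) {a b c x : V} (h : MetricTriangle G a b c)
    (hx : x ∈ interval G a b) : G.dist c x = G.dist c b := by
  refine le_antisymm
    (hG.dist_le_dist_of_mem_interval hc (fun p hp hp' => ?_) hx
      (mem_interval_comm.mp left_mem_interval))
    (hG.dist_le_dist_of_mem_interval hc (w := a) (fun p hp hp' => ?_) left_mem_interval
      (mem_interval_comm.mp hx))
  · exact h.2.2.subset ⟨mem_interval_comm.mp hp', hp⟩
  · exact h.1.subset ⟨mem_interval_comm.mp hp, hp'⟩

/-- Two vertices equidistant from `u` have a last common vertex `c`: it lies on geodesics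
from `u` to both, and no further vertex lies on geodesics from `c` to both. -/
theorem SimpleGraph.Connected.exists_maximal_mem_interval {G : SimpleGraph V}
    (hc : G.Connected) {u v w : V} (h : G.dist u v = G.dist u w) :
    ∃ c, c ∈ interval G u v ∧ c ∈ interval G u w ∧ G.dist c v = G.dist c w ∧
      ∀ p ∈ interval G c v, p ∈ interval G c w → p = c := by
  classical
  have hex : ∃ n c, c ∈ interval G u v ∧ c ∈ interval G u w ∧ G.dist c v = n :=
    ⟨_, u, left_mem_interval, left_mem_interval, rfl⟩
  obtain ⟨c, hcv, hcw, hcn⟩ := Nat.find_spec hex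
  refine ⟨c, hcv, hcw, ?_, fun p hpv hpw => ?_⟩ <;>
    simp only [interval, Set.mem_ofPred_eq] at hcv hcw
  · omega
  · simp only [interval, Set.mem_ofPred_eq] at hpv hpw
    have h1 := hc.dist_triangle (u := u) (v := c) (w := p)
    have h2 := hc.dist_triangle (u := u) (v := p) (w := v)
    have h3 := hc.dist_triangle (u := u) (v := p) (w := w)
    have h4 := Nat.find_min' hex ⟨p, show _ + _ = _ by omega, show _ + _ = _ by omega, rfl⟩
    exact (hc.dist_eq_zero_iff.mp (by omega : G.dist c p = 0)).symm

/-- Elementwise criterion for `v`, `w`, `c` to form a metric triangle. -/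
theorem metricTriangle_of_forall {G : SimpleGraph V} {c v w : V}
    (hmax : ∀ p ∈ interval G c v, p ∈ interval G c w → p = c)
    (hv : ∀ p ∈ interval G v w, p ∈ interval G v c → p = v)
    (hw : ∀ p ∈ interval G v w, p ∈ interval G w c → p = w) : MetricTriangle G v w c := by
  refine ⟨Set.Subset.antisymm ?_ ?_, Set.Subset.antisymm ?_ ?_, Set.Subset.antisymm ?_ ?_⟩
  · exact fun p hp => hw p hp.1 hp.2
  · rintro _ rfl; exact ⟨mem_interval_comm.mp left_mem_interval, left_mem_interval⟩
  · exact fun p hp => hmax p hp.2 (mem_interval_comm.mp hp.1)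
  · rintro _ rfl; exact ⟨mem_interval_comm.mp left_mem_interval, left_mem_interval⟩
  · exact fun p hp => hv p hp.2 (mem_interval_comm.mp hp.1)
  · rintro _ rfl; exact ⟨mem_interval_comm.mp left_mem_interval, left_mem_interval⟩

section StronglyEquilateral

variable {G : SimpleGraph V}

theorem triangleCondition_of_stronglyEquilateral (hc : G.Connected)
    (hE : ∀ u1 u2 u3 : V, MetricTriangle G u1 u2 u3 →
      ∀ x ∈ interval G u1 u2, G.dist u3 x = G.dist u1 u2) : TriangleCondition G := by
  intro k u v w hv hw hvw
  obtain ⟨c, hcv, hcw, hcd, hmax⟩ := hc.exists_maximal_mem_interval (hv.trans hw.symm)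
  have h1 : G.dist v w = 1 := dist_eq_one_iff_adj.mpr hvw
  have ends : ∀ p ∈ interval G v w, p = v ∨ p = w := by
    intro p hp
    have hp' : G.dist v p + G.dist p w = G.dist v w := hp
    obtain h | h : G.dist v p = 0 ∨ G.dist p w = 0 := by omega
    · exact .inl (hc.dist_eq_zero_iff.mp h).symm
    · exact .inr (hc.dist_eq_zero_iff.mp h)
  have hT : MetricTriangle G v w c := by
    refine metricTriangle_of_forall hmax
      (fun p hp hp' => ?_) (fun p hp hp' => ?_)
    · rcases ends p hp with rfl | rfl
      · rfl
      · simp only [interval, Set.mem_ofPred_eq] at hp'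
        have := G.dist_comm (u := c) (v := v)
        have := G.dist_comm (u := c) (v := p)
        omega
    · rcases ends p hp with rfl | rfl
      · simp only [interval, Set.mem_ofPred_eq] at hp'
        have := G.dist_comm (u := c) (v := p)
        have := G.dist_comm (u := c) (v := w)
        have := G.dist_comm (u := w) (v := p)
        omega
      · rfl
  have h2 := hE v w c hT v left_mem_interval
  have hcv' : G.dist u c + G.dist c v = G.dist u v := hcv
  exact ⟨c, by omega, dist_eq_one_iff_adj.mp (by omega), dist_eq_one_iff_adj.mp (by omega)⟩

theorem quadrangleCondition_of_stronglyEquilateral (hc : G.Connected)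
    (hE : ∀ u1 u2 u3 : V, MetricTriangle G u1 u2 u3 →
      ∀ x ∈ interval G u1 u2, G.dist u3 x = G.dist u1 u2) : QuadrangleCondition G := by
  intro k u v w z hv hw hz hvz hwz
  by_cases hvw : v = w
  · subst hvw
    obtain ⟨t, ht, htk⟩ := hc.exists_adj_dist_succ hv
    exact ⟨t, htk, ht, ht⟩
  by_cases hadj : G.Adj v w
  · exact triangleCondition_of_stronglyEquilateral hc hE k u v w hv hw hadj
  have hvz1 : G.dist v z = 1 := dist_eq_one_iff_adj.mpr hvz
  have hzw1 : G.dist z w = 1 := dist_eq_one_iff_adj.mpr hwz.symm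
  have hvw2 : G.dist v w = 2 := by
    have h1 := hc.dist_triangle (u := v) (v := z) (w := w)
    have h2 : G.dist v w ≠ 0 := fun h => hvw (hc.dist_eq_zero_iff.mp h)
    have h3 : G.dist v w ≠ 1 := fun h => hadj (dist_eq_one_iff_adj.mp h)
    omega
  obtain ⟨c, hcv, hcw, hcd, hmax⟩ := hc.exists_maximal_mem_interval (hv.trans hw.symm)
  have hcv' : G.dist u c + G.dist c v = G.dist u v := hcv
  by_cases hc1 : G.dist c v = 1
  · exact ⟨c, by omega, dist_eq_one_iff_adj.mp hc1, dist_eq_one_iff_adj.mp (by omega)⟩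
  have cv := G.dist_comm (u := c) (v := v)
  have cw := G.dist_comm (u := c) (v := w)
  have hT : MetricTriangle G v w c := by
    refine metricTriangle_of_forall hmax
      (fun p hp hp' => ?_) (fun p hp hp' => ?_)
    all_goals
      by_contra hne
      have pc := G.dist_comm (u := c) (v := p)
      have pv := G.dist_comm (u := p) (v := v)
      have pw := G.dist_comm (u := p) (v := w)
      have h1 := hc.dist_triangle (u := c) (v := p) (w := v)
      have h2 := hc.dist_triangle (u := c) (v := p) (w := w)
      simp only [interval, Set.mem_ofPred_eq] at hp hp' hmax
    · have h3 : G.dist v p ≠ 0 := fun h => hne (hc.dist_eq_zero_iff.mp h).symm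
      obtain rfl := hmax p (by omega) (by omega)
      omega
    · have h3 : G.dist w p ≠ 0 := fun h => hne (hc.dist_eq_zero_iff.mp h).symm
      obtain rfl := hmax p (by omega) (by omega)
      omega
  have h1 := hE v w c hT v left_mem_interval
  have h2 := hE v w c hT z (by simp only [interval, Set.mem_ofPred_eq]; omega)
  have h3 := hc.dist_triangle (u := u) (v := c) (w := z)
  omega

end StronglyEquilateral

/-- A connected graph is weakly modular iff every metric triangle is strongly
equilateral. -/
theorem stmt1 (G : SimpleGraph V) (hc : G.Connected) :
    WeaklyModular G ↔
      ∀ u1 u2 u3 : V, MetricTriangle G u1 u2 u3 →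
        ∀ x ∈ interval G u1 u2, G.dist u3 x = G.dist u1 u2 := by
  refine ⟨fun hG u1 u2 u3 hT x hx => ?_, fun hE =>
    ⟨triangleCondition_of_stronglyEquilateral hc hE,
      quadrangleCondition_of_stronglyEquilateral hc hE⟩⟩
  have h1 := hG.dist_eq_dist_of_metricTriangle hc hT hx
  have h2 := hG.dist_eq_dist_of_metricTriangle hc hT left_mem_interval
  have h3 := hG.dist_eq_dist_of_metricTriangle hc hT.rotate left_mem_interval
  rw [h1, ← h2, h3, G.dist_comm]
end

section
/- In a K4-free bridged graph G, every fiber F(x) of the star St(z) induces an isometric subgraph of G (in particular, a bridged subgraph). -/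
open SimpleGraph

variable {V : Type*}

section Fibers

variable {G : SimpleGraph V}

theorem dist_le_dist_add_one_of_adj (hc : G.Connected) {a b : V} (h : G.Adj a b) (c : V) :
    G.dist c a ≤ G.dist c b + 1 := by
  have h1 := hc.dist_triangle (u := c) (v := b) (w := a)
  rwa [SimpleGraph.dist_eq_one_iff_adj.2 h.symm] at h1

theorem exists_adj_dist_eq (hc : G.Connected) {u v : V} {n : ℕ} (h : G.dist u v = n + 1) :
    ∃ w, G.Adj u w ∧ G.dist w v = n := by
  obtain ⟨p, hp⟩ := hc.exists_walk_length_eq_dist u v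
  cases p with
  | nil => simp at h
  | @cons _ w _ hw q =>
    refine ⟨w, hw, ?_⟩
    have h1 := SimpleGraph.dist_le q
    have h2 := dist_le_dist_add_one_of_adj hc hw v
    rw [SimpleGraph.dist_comm (u := v) (v := u), SimpleGraph.dist_comm (u := v) (v := w)] at h2
    rw [SimpleGraph.Walk.length_cons] at hp
    omega

/-- The neighbors of `t` that are closer to `u` form a clique. -/
theorem Bridged.adj_of_dist_eq (hb : Bridged G) (hc : G.Connected) {u v w t : V} {k : ℕ}
    (ht : G.dist u t = k + 1) (hv : G.dist u v = k) (hw : G.dist u w = k)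
    (hvt : G.Adj v t) (hwt : G.Adj w t) (hne : v ≠ w) : G.Adj v w := by
  rcases k with _ | k
  · exact absurd ((hc.dist_eq_zero_iff.1 hv).symm.trans (hc.dist_eq_zero_iff.1 hw)) hne
  obtain ⟨x, hx, hxv, hxw⟩ := hb.1.2 k u v w t hv hw ht hvt hwt
  by_contra hvw
  refine hb.2.1 ⟨x, v, t, w, hxv, hvt, hwt.symm, hxw.symm, ?_, hne, ?_, hvw⟩
  · rintro rfl
    omega
  · intro h
    have := dist_le_dist_add_one_of_adj hc h.symm u
    omega

/-- A pair `u, v` with `u` at least as far from `x` as `v` either admits a step from `u` towards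
both `v` and `x`, or both vertices can be moved towards `x` so that their distance drops. -/
theorem Bridged.exists_step (hb : Bridged G) (hc : G.Connected) (x : V) (k : ℕ) :
    ∀ u v : V, G.dist u v = k + 1 → G.dist x v ≤ G.dist x u →
      (∃ q, G.Adj u q ∧ G.dist x q + 1 = G.dist x u ∧ G.dist q v = k) ∨
      (G.dist x u = G.dist x v ∧ ∃ q r, G.Adj u q ∧ G.Adj v r ∧
        G.dist x q + 1 = G.dist x u ∧ G.dist x r + 1 = G.dist x v ∧ G.dist q r = k) := by
  induction k with
  | zero =>
    intro u v huv hle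
    have hadj : G.Adj u v := SimpleGraph.dist_eq_one_iff_adj.1 huv
    rcases hle.lt_or_eq with hlt | heq
    · have := dist_le_dist_add_one_of_adj hc hadj x
      exact Or.inl ⟨v, hadj, by omega, by simp⟩
    · rcases h : G.dist x u with _ | n
      · rw [h] at heq
        exact absurd ((hc.dist_eq_zero_iff.1 h).symm.trans (hc.dist_eq_zero_iff.1 heq)) hadj.ne
      · obtain ⟨q, hq, hqu, hqv⟩ := hb.1.1 n x u v h (heq.trans h) hadj
        exact Or.inr ⟨by omega, q, q, hqu.symm, hqv.symm, by omega, by omega, by simp⟩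
  | succ k ih =>
    intro u v huv hle
    obtain ⟨p, hup, hpv⟩ := exists_adj_dist_eq hc huv
    have h1 := dist_le_dist_add_one_of_adj hc hup x
    have h2 := dist_le_dist_add_one_of_adj hc hup.symm x
    rcases Nat.lt_trichotomy (G.dist x p) (G.dist x u) with hlt | heq | hgt
    · exact Or.inl ⟨p, hup, by omega, hpv⟩
    · have shortcut : ∀ q, G.Adj u q → G.dist x q + 1 = G.dist x u → G.dist q v ≤ k + 1 →
          ∃ q, G.Adj u q ∧ G.dist x q + 1 = G.dist x u ∧ G.dist q v = k + 1 := by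
        intro q huq hq hqv
        have := dist_le_dist_add_one_of_adj hc huq v
        rw [SimpleGraph.dist_comm (u := v) (v := u), SimpleGraph.dist_comm (u := v) (v := q)] at this
        exact ⟨q, huq, hq, by omega⟩
      rcases h : G.dist x u with _ | n
      · have h0 : G.dist x v = 0 := by omega
        have h3 := (hc.dist_eq_zero_iff.1 h).symm.trans (hc.dist_eq_zero_iff.1 h0)
        rw [h3, SimpleGraph.dist_self] at huv
        omega
      rw [← h]
      obtain ⟨q, hq, hqu, hqp⟩ := hb.1.1 n x u p h (heq.trans h) hup
      have near : ∀ q', G.Adj p q' → G.dist x q' = n → ∀ c, G.dist q c ≤ G.dist q' c + 1 := by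
        intro q' hpq' hq' c
        rcases eq_or_ne q q' with rfl | hne
        · omega
        · have := dist_le_dist_add_one_of_adj hc
            (hb.adj_of_dist_eq hc (heq.trans h) hq hq' hqp hpq'.symm hne) c
          rwa [SimpleGraph.dist_comm (u := c) (v := q), SimpleGraph.dist_comm (u := c) (v := q')] at this
      rcases ih p v hpv (by omega) with ⟨q', hpq', hq', hq'v⟩ | ⟨hab, q', r, hpq', hvr, hq', hr, hq'r⟩
      · have := near q' hpq' (by omega) v
        exact Or.inl (shortcut q hqu.symm (by omega) (by omega))
      · have h3 := near q' hpq' (by omega) r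
        by_cases h4 : G.dist q r = k + 1
        · exact Or.inr ⟨by omega, q, r, hqu.symm, hvr, by omega, hr, h4⟩
        · have := dist_le_dist_add_one_of_adj hc hvr q
          exact Or.inl (shortcut q hqu.symm (by omega) (by omega))
    · rcases ih p v hpv (by omega) with ⟨q, hpq, hq, hqv⟩ | ⟨hab, -⟩
      · rcases eq_or_ne u q with rfl | hne
        · omega
        · have := dist_le_dist_add_one_of_adj hc
            (hb.adj_of_dist_eq hc (u := x) (k := G.dist x u) (by omega) rfl (by omega)
              hup hpq.symm hne) v
          rw [SimpleGraph.dist_comm (u := v) (v := u), SimpleGraph.dist_comm (u := v) (v := q)] at this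
          omega
      · omega

/-- `F` contains every neighbor of its vertices that is closer to `x`. -/
def DownClosed (G : SimpleGraph V) (x : V) (F : Set V) : Prop :=
  ∀ u q, u ∈ F → G.Adj u q → G.dist x q + 1 = G.dist x u → q ∈ F

/-- `F` contains every vertex having two neighbors in `F` that are closer to `x`. -/
def TwoDownClosed (G : SimpleGraph V) (x : V) (F : Set V) : Prop :=
  ∀ p q r, q ∈ F → r ∈ F → q ≠ r → G.Adj p q → G.Adj p r →
    G.dist x q + 1 = G.dist x p → G.dist x r + 1 = G.dist x p → p ∈ F

theorem Bridged.exists_step_mem (hb : Bridged G) (hc : G.Connected) {x : V} {F : Set V}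
    (hA : DownClosed G x F) (hB : TwoDownClosed G x F) {n : ℕ}
    (ih : ∀ (u v : V) (hu : u ∈ F) (hv : v ∈ F), G.dist u v = n →
      ∃ w : (G.induce F).Walk ⟨u, hu⟩ ⟨v, hv⟩, w.length = n)
    {u v : V} (hu : u ∈ F) (hv : v ∈ F) (huv : G.dist u v = n + 1)
    (hle : G.dist x v ≤ G.dist x u) : ∃ q ∈ F, G.Adj u q ∧ G.dist q v = n := by
  rcases n with _ | n
  · exact ⟨v, hv, SimpleGraph.dist_eq_one_iff_adj.1 huv, by simp⟩
  rcases hb.exists_step hc x (n + 1) u v huv hle with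
    ⟨q, huq, hq, hqv⟩ | ⟨hab, q, s, huq, hvs, hq, hs, hqs⟩
  · exact ⟨q, hA u q hu huq hq, huq, hqv⟩
  have hqF := hA u q hu huq hq
  have hsF := hA v s hv hvs hs
  by_contra hno
  push Not at hno
  have h1 := hno q hqF huq
  have h2 := dist_le_dist_add_one_of_adj hc huq v
  have h3 := dist_le_dist_add_one_of_adj hc hvs q
  rw [SimpleGraph.dist_comm (u := v) (v := u), SimpleGraph.dist_comm (u := v) (v := q)] at h2
  have hqv : G.dist v q = n + 1 + 1 := by rw [SimpleGraph.dist_comm]; omega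
  obtain ⟨p, hp, hpu, hpq⟩ := hb.1.1 (n + 1) v u q (by rw [SimpleGraph.dist_comm]; exact huv) hqv huq
  have hpv : G.dist p v = n + 1 := by rw [SimpleGraph.dist_comm]; exact hp
  have hpF : p ∉ F := fun h => hno p h hpu.symm hpv
  have hpx : G.dist x p = G.dist x u := by
    have h4 := dist_le_dist_add_one_of_adj hc hpu.symm x
    have h5 := dist_le_dist_add_one_of_adj hc hpq x
    by_contra h6
    exact hpF (hA u p hu hpu.symm (by omega))
  obtain ⟨w, hw⟩ := ih q s hqF hsF hqs
  cases w with
  | nil => simp at hw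
  | @cons _ r _ hr t =>
    obtain ⟨r, hrF⟩ := r
    have hqr : G.Adj q r := hr
    have hrs : G.dist r s ≤ n := by
      have h4 := SimpleGraph.dist_le (t.map (SimpleGraph.Embedding.induce F).toHom)
      rw [SimpleGraph.Walk.length_map] at h4
      rw [SimpleGraph.Walk.length_cons] at hw
      have h5 : G.dist r s ≤ t.length := h4
      omega
    have hrs' := dist_le_dist_add_one_of_adj hc hqr s
    rw [SimpleGraph.dist_comm (u := s) (v := q), SimpleGraph.dist_comm (u := s) (v := r)] at hrs'
    have hvr : G.dist v r = n + 1 := by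
      have h4 := dist_le_dist_add_one_of_adj hc hvs r
      have h5 := dist_le_dist_add_one_of_adj hc hqr v
      rw [SimpleGraph.dist_comm (u := r) (v := v)] at h4
      omega
    have hpr : p ≠ r := fun h => hpF (h ▸ hrF)
    have hadj := hb.adj_of_dist_eq hc hqv hp hvr hpq hqr.symm hpr
    have hrx : G.dist x r + 1 = G.dist x p := by
      have h4 := dist_le_dist_add_one_of_adj hc hadj x
      have h5 := dist_le_dist_add_one_of_adj hc hqr.symm x
      by_contra h6
      have h7 : G.dist x r = G.dist x u := by omega
      rcases n with _ | n
      · have : r = s := hc.dist_eq_zero_iff.1 (by omega)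
        subst this
        omega
      rcases hb.exists_step hc x n r s (by omega) (by omega) with ⟨y, hry, hy, hys⟩ | ⟨h8, -⟩
      · rcases eq_or_ne q y with rfl | hne
        · omega
        · have := dist_le_dist_add_one_of_adj hc
            (hb.adj_of_dist_eq hc (u := x) (k := G.dist x q) (by omega) rfl (by omega)
              hqr hry.symm hne) s
          rw [SimpleGraph.dist_comm (u := s) (v := q), SimpleGraph.dist_comm (u := s) (v := y)] at this
          omega
      · omega
    exact hpF (hB p q r hqF hrF hqr.ne hpq hadj (by omega) hrx)

theorem Bridged.exists_walk_induce (hb : Bridged G) (hc : G.Connected) {x : V} {F : Set V}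
    (hA : DownClosed G x F) (hB : TwoDownClosed G x F) (n : ℕ) :
    ∀ (u v : V) (hu : u ∈ F) (hv : v ∈ F), G.dist u v = n →
      ∃ w : (G.induce F).Walk ⟨u, hu⟩ ⟨v, hv⟩, w.length = n := by
  induction n with
  | zero =>
    intro u v hu hv h
    obtain rfl := hc.dist_eq_zero_iff.1 h
    exact ⟨.nil, rfl⟩
  | succ n ih =>
    intro u v hu hv huv
    rcases le_total (G.dist x v) (G.dist x u) with hle | hle
    · obtain ⟨q, hq, huq, hqv⟩ := hb.exists_step_mem hc hA hB ih hu hv huv hle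
      obtain ⟨w, hw⟩ := ih q v hq hv hqv
      have hadj : (G.induce F).Adj ⟨u, hu⟩ ⟨q, hq⟩ := huq
      exact ⟨.cons hadj w, by simp [hw]⟩
    · rw [SimpleGraph.dist_comm] at huv
      obtain ⟨q, hq, hvq, hqu⟩ := hb.exists_step_mem hc hA hB ih hv hu huv hle
      obtain ⟨w, hw⟩ := ih q u hq hu hqu
      have hadj : (G.induce F).Adj ⟨v, hv⟩ ⟨q, hq⟩ := hvq
      exact ⟨(SimpleGraph.Walk.cons hadj w).reverse, by simp [hw]⟩

theorem dist_induce_eq {F : Set V}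
    (hF : ∀ (u v : V) (hu : u ∈ F) (hv : v ∈ F),
      ∃ w : (G.induce F).Walk ⟨u, hu⟩ ⟨v, hv⟩, w.length = G.dist u v) (u v : F) :
    (G.induce F).dist u v = G.dist (u : V) v := by
  obtain ⟨w, hw⟩ := hF u v u.2 v.2
  refine le_antisymm (hw ▸ SimpleGraph.dist_le w) ?_
  obtain ⟨t, ht⟩ := w.reachable.exists_walk_length_eq_dist
  have h := SimpleGraph.dist_le (t.map (SimpleGraph.Embedding.induce F).toHom)
  rw [SimpleGraph.Walk.length_map, ht] at h
  exact h

/-- Isometric subgraphs of bridged graphs are bridged. -/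
theorem Bridged.induce (hb : Bridged G) (hc : G.Connected) {F : Set V}
    (hF : ∀ (u v : V) (hu : u ∈ F) (hv : v ∈ F),
      ∃ w : (G.induce F).Walk ⟨u, hu⟩ ⟨v, hv⟩, w.length = G.dist u v) :
    Bridged (G.induce F) := by
  have hd := dist_induce_eq hF
  have down : ∀ (u v : F) (k : ℕ), G.dist (u : V) v = k + 1 →
      ∃ w : F, G.Adj w v ∧ G.dist (u : V) w = k := by
    intro u v k h
    obtain ⟨w, hw⟩ := hF v u v.2 u.2
    have : (G.induce F).Connected := by
      have : Nonempty F := ⟨u⟩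
      exact ⟨fun a b => ⟨(hF a b a.2 b.2).choose⟩⟩
    obtain ⟨q, hvq, hq⟩ := exists_adj_dist_eq (u := v) (v := u) this
      (by rw [hd, SimpleGraph.dist_comm]; exact h)
    exact ⟨q, SimpleGraph.Adj.symm hvq, by rw [SimpleGraph.dist_comm, ← hd]; exact hq⟩
  have tc : TriangleCondition (G.induce F) := by
    intro k u v w hv hw hvw
    have hvw : G.Adj (v : V) w := hvw
    rw [hd] at hv hw
    obtain ⟨v', hv', hv'k⟩ := down u v k hv
    obtain ⟨w', hw', hw'k⟩ := down u w k hw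
    by_cases c1 : G.Adj (v' : V) w
    · exact ⟨v', by rw [hd]; exact hv'k, hv', c1⟩
    by_cases c2 : G.Adj (w' : V) v
    · exact ⟨w', by rw [hd]; exact hw'k, c2, hw'⟩
    have hne : (v' : V) ≠ w' := fun h => c1 (h ▸ hw')
    have hv'w : (v' : V) ≠ w := by intro h; rw [h] at hv'k; omega
    have hw'v : (w' : V) ≠ v := by intro h; rw [h] at hw'k; omega
    have c3 : ¬ G.Adj (v' : V) w' := fun h =>
      hb.2.1 ⟨v', v, w, w', hv', hvw, hw'.symm, h.symm, hv'w, hw'v.symm, c1, fun h => c2 h.symm⟩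
    obtain ⟨t, hv't, htw'⟩ : ∃ t : F, G.Adj (v' : V) t ∧ G.Adj (t : V) w' := by
      obtain ⟨y, hy, hyv, hyw⟩ := hb.1.1 k u v w hv hw hvw
      have n1 : y ≠ v' := fun h => c1 (h ▸ hyw)
      have n2 : y ≠ w' := fun h => c2 (h ▸ hyv)
      have a1 := hb.adj_of_dist_eq hc hv hy hv'k hyv hv' n1
      have a2 := hb.adj_of_dist_eq hc hw hy hw'k hyw hw' n2
      have h2 : G.dist (w' : V) v' = 1 + 1 := by
        have h3 := SimpleGraph.dist_le (SimpleGraph.Walk.cons a2.symm (.cons a1 .nil))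
        have h4 : G.dist (w' : V) v' ≠ 1 := fun h =>
          c3 (SimpleGraph.dist_eq_one_iff_adj.1 h).symm
        have h5 : G.dist (w' : V) v' ≠ 0 := fun h => hne (hc.dist_eq_zero_iff.1 h).symm
        simp only [SimpleGraph.Walk.length_cons, SimpleGraph.Walk.length_nil] at h3
        omega
      obtain ⟨t, ht, hwt⟩ := down w' v' 1 h2
      exact ⟨t, ht.symm, (SimpleGraph.dist_eq_one_iff_adj.1 hwt).symm⟩
    have htv' : (t : V) ≠ v := fun h => c2 (h ▸ htw').symm
    have htw : (t : V) ≠ w := fun h => c1 (h ▸ hv't)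
    have htvw : G.Adj (t : V) v ∧ G.Adj (t : V) w := by
      by_cases d1 : G.Adj (t : V) v
      · refine ⟨d1, ?_⟩
        by_contra d2
        exact hb.2.1 ⟨t, v, w, w', d1, hvw, hw'.symm, htw'.symm, htw, hw'v.symm, d2,
          fun h => c2 h.symm⟩
      · exfalso
        by_cases d2 : G.Adj (t : V) w
        · exact hb.2.1 ⟨t, w, v, v', d2, hvw.symm, hv'.symm, hv't, htv', hv'w.symm, d1,
            fun h => c1 h.symm⟩
        · exact hb.2.2 ⟨t, v', v, w, w', hv't.symm, hv', hvw, hw'.symm, htw'.symm, htv', htw,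
            hv'w, hne, hw'v.symm, d1, d2, c1, c3, fun h => c2 h.symm⟩
    refine ⟨t, ?_, htvw.1, htvw.2⟩
    rw [hd]
    have e1 := dist_le_dist_add_one_of_adj hc htw' u
    have e2 := dist_le_dist_add_one_of_adj hc htvw.1.symm u
    by_contra e3
    exact c3 (hb.adj_of_dist_eq hc (t := (t : V)) (by omega) hv'k hw'k hv't htw'.symm hne)
  refine ⟨⟨tc, ?_⟩, ?_, ?_⟩
  · intro k u v w t hv hw ht hvt hwt
    rcases eq_or_ne v w with rfl | hne
    · rw [hd] at hv
      obtain ⟨q, hqv, hq⟩ := down u v k hv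
      exact ⟨q, by rw [hd]; exact hq, hqv, hqv⟩
    · refine tc k u v w hv hw ?_
      rw [hd] at hv hw ht
      exact hb.adj_of_dist_eq hc ht hv hw hvt hwt (fun h => hne (Subtype.ext h))
  · rintro ⟨a, b, c, d, h1, h2, h3, h4, h5, h6, h7, h8⟩
    exact hb.2.1 ⟨a, b, c, d, h1, h2, h3, h4, fun h => h5 (Subtype.ext h),
      fun h => h6 (Subtype.ext h), h7, h8⟩
  · rintro ⟨a, b, c, d, e, h1, h2, h3, h4, h5, n1, n2, n3, n4, n5, m1, m2, m3, m4, m5⟩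
    exact hb.2.2 ⟨a, b, c, d, e, h1, h2, h3, h4, h5, fun h => n1 (Subtype.ext h),
      fun h => n2 (Subtype.ext h), fun h => n3 (Subtype.ext h), fun h => n4 (Subtype.ext h),
      fun h => n5 (Subtype.ext h), m1, m2, m3, m4, m5⟩

/-- If `x` and its neighbor `y` are both within distance `n + 1` of `p`, some neighbor of `p` is
within distance `n` of both. -/
theorem Bridged.exists_adj_dist_le (hb : Bridged G) (hc : G.Connected) {p x y : V} {n : ℕ}
    (hxy : G.Adj x y) (hx : G.dist p x = n + 1) (hy : G.dist p y ≤ n + 1) (hn : n ≠ 0) :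
    ∃ s, G.Adj p s ∧ G.dist s x = n ∧ G.dist s y ≤ n := by
  obtain ⟨s, hps, hsx, hsy⟩ : ∃ s, G.Adj p s ∧ G.dist s x ≤ n ∧ G.dist s y ≤ n := by
    rcases hy.lt_or_eq with hlt | heq
    · have h1 := dist_le_dist_add_one_of_adj hc hxy p
      obtain ⟨m, rfl⟩ := Nat.exists_eq_succ_of_ne_zero hn
      obtain ⟨s, hps, hs⟩ := exists_adj_dist_eq hc (u := p) (v := y) (n := m) (by omega)
      have h2 := dist_le_dist_add_one_of_adj hc hxy s
      exact ⟨s, hps, by omega, by omega⟩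
    · obtain ⟨t, ht, htx, hty⟩ := hb.1.1 n p x y hx heq hxy
      obtain ⟨m, rfl⟩ := Nat.exists_eq_succ_of_ne_zero hn
      obtain ⟨s, hps, hs⟩ := exists_adj_dist_eq hc ht
      have h2 := dist_le_dist_add_one_of_adj hc htx.symm s
      have h3 := dist_le_dist_add_one_of_adj hc hty.symm s
      exact ⟨s, hps, by omega, by omega⟩
  have h4 := dist_le_dist_add_one_of_adj hc hps x
  rw [SimpleGraph.dist_comm (u := x) (v := p), SimpleGraph.dist_comm (u := x) (v := s)] at h4
  exact ⟨s, hps, by omega, hsy⟩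

/-- In a `K₄`-free bridged graph, if `q` and `r` are two neighbors of `p` closer to `x`, both at
distance more than `n` from a neighbor `y` of `x`, then `y` is farther from `p` than `x`. -/
theorem Bridged.lt_dist_of_two_down (hb : Bridged G) (hc : G.Connected) (hk4 : K4Free G)
    {p q r x y : V} {n : ℕ} (hxy : G.Adj x y) (hp : G.dist p x = n + 1) (hq : G.dist q x = n)
    (hr : G.dist r x = n) (hpq : G.Adj p q) (hpr : G.Adj p r) (hne : q ≠ r)
    (hqy : n < G.dist q y) (hry : n < G.dist r y) : n + 1 < G.dist p y := by
  by_contra hlt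
  have hn : n ≠ 0 := by
    rintro rfl
    exact hne ((hc.dist_eq_zero_iff.1 hq).trans (hc.dist_eq_zero_iff.1 hr).symm)
  obtain ⟨s, hps, hsx, hsy⟩ := hb.exists_adj_dist_le hc hxy hp (by omega) hn
  rw [SimpleGraph.dist_comm] at hp hq hr hsx
  have hqs : q ≠ s := by rintro rfl; omega
  have hrs : r ≠ s := by rintro rfl; omega
  exact hk4 ⟨p, q, r, s, hpq, hpr, hps, hb.adj_of_dist_eq hc hp hq hr hpq.symm hpr.symm hne,
    hb.adj_of_dist_eq hc hp hq hsx hpq.symm hps.symm hqs,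
    hb.adj_of_dist_eq hc hp hr hsx hpr.symm hps.symm hrs⟩

theorem mem_panelFiber_iff {z x u : V} (hxz : G.Adj x z) :
    u ∈ panelFiber G z x ↔ ∀ y ∈ closedNbhd G z, y ≠ x → G.dist u x < G.dist u y := by
  have hxN : x ∈ closedNbhd G z := Or.inr hxz.symm
  constructor
  · intro h y hy hyx
    have h : mproj G u (closedNbhd G z) = {x} := h
    have hx : x ∈ mproj G u (closedNbhd G z) := h ▸ rfl
    refine lt_of_le_of_ne (hx.2 y hy) fun he => hyx ?_
    have : y ∈ mproj G u (closedNbhd G z) := ⟨hy, fun b hb => he ▸ hx.2 b hb⟩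
    rw [h] at this
    exact this
  · intro h
    ext y
    constructor
    · intro hy
      by_contra hyx
      exact absurd (hy.2 x hxN) (not_le.2 (h y hy.1 hyx))
    · rintro rfl
      refine ⟨hxN, fun b hb => ?_⟩
      rcases eq_or_ne b y with rfl | hne
      · rfl
      · exact (h b hb hne).le

theorem panelFiber_downClosed (hc : G.Connected) {z x : V} (hxz : G.Adj x z) :
    DownClosed G x (panelFiber G z x) := by
  intro u q hu huq hq
  rw [mem_panelFiber_iff hxz] at hu ⊢
  intro y hy hyx
  have h1 := hu y hy hyx
  have h2 := dist_le_dist_add_one_of_adj hc huq y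
  rw [SimpleGraph.dist_comm (u := y) (v := u), SimpleGraph.dist_comm (u := y) (v := q)] at h2
  rw [SimpleGraph.dist_comm (u := x) (v := q), SimpleGraph.dist_comm (u := x) (v := u)] at hq
  omega

theorem Bridged.panelFiber_twoDownClosed (hb : Bridged G) (hc : G.Connected) (hk4 : K4Free G)
    {z x : V} (hxz : G.Adj x z) : TwoDownClosed G x (panelFiber G z x) := by
  intro p q r hq hr hne hpq hpr hqx hrx
  rw [mem_panelFiber_iff hxz] at hq hr ⊢
  rw [SimpleGraph.dist_comm (u := x) (v := p)] at hqx hrx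
  rw [SimpleGraph.dist_comm] at hqx hrx
  have key : ∀ y ∈ closedNbhd G z, G.Adj x y → G.dist p x < G.dist p y := by
    intro y hy hxy
    have h1 := hq y hy hxy.ne'
    have h2 := hr y hy hxy.ne'
    have := hb.lt_dist_of_two_down hc hk4 hxy hqx.symm rfl (by omega) hpq hpr hne h1 (by omega)
    omega
  intro y hy hyx
  by_cases hxy : G.Adj x y
  · exact key y hy hxy
  rcases hy with rfl | hzy
  · exact absurd hxz hxy
  have hzy : G.Adj z y := hzy
  have h1 := key z (Or.inl rfl) hxz
  have h2 := dist_le_dist_add_one_of_adj hc hxz.symm p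
  have h3 := dist_le_dist_add_one_of_adj hc hzy p
  by_contra h4
  exact hxy (hb.adj_of_dist_eq hc (u := p) (t := z) (by omega) rfl (by omega) hxz hzy.symm hyx.symm)

theorem Bridged.adj_of_common_neighbors (hb : Bridged G) {x z a b : V} (hne : x ≠ z)
    (hxz : ¬ G.Adj x z) (hxa : G.Adj x a) (hza : G.Adj z a) (hxb : G.Adj x b) (hzb : G.Adj z b)
    (hab : a ≠ b) : G.Adj a b := by
  by_contra h
  exact hb.2.1 ⟨x, a, z, b, hxa, hza.symm, hzb, hxb.symm, hne, hab, hxz, h⟩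

/-- In a `K₄`-free bridged graph, a vertex `x` at distance two from `z` has no common neighbors
with `z` besides the endpoints of a given common edge. -/
theorem Bridged.eq_or_eq_of_common_neighbor (hb : Bridged G) (hk4 : K4Free G) {x z y y' a : V}
    (hne : x ≠ z) (hxz : ¬ G.Adj x z) (hyy' : G.Adj y y') (hzy : G.Adj z y) (hzy' : G.Adj z y')
    (hxy : G.Adj x y) (hxy' : G.Adj x y') (hxa : G.Adj x a) (hza : G.Adj z a) :
    a = y ∨ a = y' := by
  by_contra h
  push Not at h
  exact hk4 ⟨z, a, y, y', hza, hzy, hzy',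
    hb.adj_of_common_neighbors hne hxz hxa hza hxy hzy h.1,
    hb.adj_of_common_neighbors hne hxz hxa hza hxy' hzy' h.2, hyy'⟩

theorem Bridged.mem_coneFiber_iff (hb : Bridged G) (hk4 : K4Free G) {x z y y' u : V}
    (hne : x ≠ z) (hxz : ¬ G.Adj x z) (hyy' : G.Adj y y') (hzy : G.Adj z y) (hzy' : G.Adj z y')
    (hxy : G.Adj x y) (hxy' : G.Adj x y') :
    u ∈ coneFiber G z x ↔ G.dist u y = G.dist u x + 1 ∧ G.dist u y' = G.dist u x + 1 ∧
      ∀ w ∈ closedNbhd G z, w ≠ y → w ≠ y' → G.dist u x + 1 < G.dist u w := by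
  constructor
  · rintro ⟨a, a', haa', -, hza, hza', hxa, hxa', hproj, hd⟩
    have h1 := hb.eq_or_eq_of_common_neighbor hk4 hne hxz hyy' hzy hzy' hxy hxy' hxa hza
    have h2 := hb.eq_or_eq_of_common_neighbor hk4 hne hxz hyy' hzy hzy' hxy hxy' hxa' hza'
    have hproj' : mproj G u (closedNbhd G z) = {y, y'} := by
      rw [hproj]
      rcases h1 with rfl | rfl <;> rcases h2 with rfl | rfl
      · exact absurd rfl haa'
      · rfl
      · exact Set.pair_comm _ _
      · exact absurd rfl haa'
    have hay : a ∈ mproj G u (closedNbhd G z) := hproj ▸ Or.inl rfl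
    have hy : y ∈ mproj G u (closedNbhd G z) := hproj' ▸ Or.inl rfl
    have hy' : y' ∈ mproj G u (closedNbhd G z) := hproj' ▸ Or.inr rfl
    have e1 := hay.2 y hy.1
    have e2 := hy.2 a hay.1
    have e3 := hay.2 y' hy'.1
    have e4 := hy'.2 a hay.1
    refine ⟨by omega, by omega, fun w hw hwy hwy' => ?_⟩
    have e5 := hay.2 w hw
    by_contra hlt
    have : w ∈ mproj G u (closedNbhd G z) :=
      ⟨hw, fun b hb => (by omega : G.dist u w = G.dist u a) ▸ hay.2 b hb⟩
    rw [hproj'] at this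
    exact this.elim hwy hwy'
  · rintro ⟨h1, h2, h3⟩
    refine ⟨y, y', hyy'.ne, hyy', hzy, hzy', hxy, hxy', ?_, h1.symm⟩
    have hmin : ∀ b ∈ closedNbhd G z, G.dist u x + 1 ≤ G.dist u b := by
      intro b hb
      by_cases e1 : b = y
      · rw [e1]; omega
      by_cases e2 : b = y'
      · rw [e2]; omega
      exact (h3 b hb e1 e2).le
    ext w
    constructor
    · intro hw
      by_contra hwy
      rw [Set.mem_insert_iff, Set.mem_singleton_iff, not_or] at hwy
      have e1 := h3 w hw.1 hwy.1 hwy.2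
      have e2 := hw.2 y (Or.inr hzy)
      omega
    · rintro (rfl | rfl)
      · exact ⟨Or.inr hzy, fun b hb => h1 ▸ hmin b hb⟩
      · exact ⟨Or.inr hzy', fun b hb => h2 ▸ hmin b hb⟩

theorem Bridged.coneFiber_downClosed (hb : Bridged G) (hc : G.Connected) (hk4 : K4Free G)
    {x z y y' : V} (hne : x ≠ z) (hxz : ¬ G.Adj x z) (hyy' : G.Adj y y') (hzy : G.Adj z y)
    (hzy' : G.Adj z y') (hxy : G.Adj x y) (hxy' : G.Adj x y') :
    DownClosed G x (coneFiber G z x) := by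
  intro u q hu huq hq
  rw [hb.mem_coneFiber_iff hk4 hne hxz hyy' hzy hzy' hxy hxy'] at hu ⊢
  obtain ⟨h1, h2, h3⟩ := hu
  rw [SimpleGraph.dist_comm (u := x) (v := q), SimpleGraph.dist_comm (u := x) (v := u)] at hq
  have key : ∀ w, G.dist u w ≤ G.dist q w + 1 := by
    intro w
    rw [SimpleGraph.dist_comm (u := u) (v := w), SimpleGraph.dist_comm (u := q) (v := w)]
    exact dist_le_dist_add_one_of_adj hc huq w
  have e1 := dist_le_dist_add_one_of_adj hc hxy.symm q
  have e2 := dist_le_dist_add_one_of_adj hc hxy'.symm q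
  have e3 := key y
  have e4 := key y'
  refine ⟨by omega, by omega, fun w hw hwy hwy' => ?_⟩
  have e5 := h3 w hw hwy hwy'
  have e6 := key w
  omega

theorem Bridged.coneFiber_twoDownClosed (hb : Bridged G) (hc : G.Connected) (hk4 : K4Free G)
    {x z y y' : V} (hne : x ≠ z) (hxz : ¬ G.Adj x z) (hyy' : G.Adj y y') (hzy : G.Adj z y)
    (hzy' : G.Adj z y') (hxy : G.Adj x y) (hxy' : G.Adj x y') :
    TwoDownClosed G x (coneFiber G z x) := by
  intro p q r hq hr hqr hpq hpr hqx hrx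
  rw [hb.mem_coneFiber_iff hk4 hne hxz hyy' hzy hzy' hxy hxy'] at hq hr ⊢
  rw [SimpleGraph.dist_comm (u := x) (v := p)] at hqx hrx
  rw [SimpleGraph.dist_comm] at hqx hrx
  obtain ⟨q1, q2, -⟩ := hq
  obtain ⟨r1, r2, -⟩ := hr
  have l1 := hb.lt_dist_of_two_down hc hk4 hxy hqx.symm rfl (by omega) hpq hpr hqr
    (by omega) (by omega)
  have l2 := hb.lt_dist_of_two_down hc hk4 hxy' hqx.symm rfl (by omega) hpq hpr hqr
    (by omega) (by omega)
  have e1 := dist_le_dist_add_one_of_adj hc hxy.symm p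
  have e2 := dist_le_dist_add_one_of_adj hc hxy'.symm p
  have hy : G.dist p y = G.dist p x + 1 := by omega
  have hy' : G.dist p y' = G.dist p x + 1 := by omega
  have hz : G.dist p x + 1 < G.dist p z := by
    have e3 := dist_le_dist_add_one_of_adj hc hzy.symm p
    by_contra hlt
    by_cases e4 : G.dist p z = G.dist p x
    · exact hxz (hb.adj_of_dist_eq hc hy rfl e4 hxy hzy hne)
    · obtain ⟨t, ht, hty, htz⟩ := hb.1.1 _ p y z hy (by omega) hzy.symm
      have htx : x ≠ t := fun h => hxz (h ▸ htz)
      have hxt := hb.adj_of_dist_eq hc hy rfl ht hxy hty htx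
      rcases hb.eq_or_eq_of_common_neighbor hk4 hne hxz hyy' hzy hzy' hxy hxy' hxt htz.symm with
        rfl | rfl <;> omega
  refine ⟨hy, hy', fun w hw hwy hwy' => ?_⟩
  rcases hw with rfl | hzw
  · exact hz
  have hzw : G.Adj z w := hzw
  have e3 := dist_le_dist_add_one_of_adj hc hzy p
  have e4 := dist_le_dist_add_one_of_adj hc hzw p
  by_contra hlt
  have hdz : G.dist p z = G.dist p x + 1 + 1 := by omega
  have hdw : G.dist p w = G.dist p x + 1 := by omega
  exact hk4 ⟨z, w, y, y', hzw, hzy, hzy',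
    hb.adj_of_dist_eq hc hdz hdw hy hzw.symm hzy.symm hwy,
    hb.adj_of_dist_eq hc hdz hdw hy' hzw.symm hzy'.symm hwy', hyy'⟩

theorem fiberSet_eq_panelFiber {z x : V} (h : G.Adj x z) : fiberSet G z x = panelFiber G z x := by
  ext u
  simp [fiberSet, h]

theorem fiberSet_eq_coneFiber {z x : V} (h : ¬ G.Adj x z) : fiberSet G z x = coneFiber G z x := by
  ext u
  simp [fiberSet, h]

theorem coneFiber_self (z : V) : coneFiber G z z = ∅ := by
  ext u
  simp only [Set.mem_empty_iff_false, iff_false]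
  rintro ⟨y, y', -, -, -, -, -, -, hproj, hd⟩
  have hy : y ∈ mproj G u (closedNbhd G z) := hproj ▸ Or.inl rfl
  have := hy.2 z (Or.inl rfl)
  omega

theorem Bridged.fiberSet_closed (hb : Bridged G) (hc : G.Connected) (hk4 : K4Free G) {z x : V}
    (hx : x ∈ starSet G z) :
    DownClosed G x (fiberSet G z x) ∧ TwoDownClosed G x (fiberSet G z x) := by
  by_cases hxz : G.Adj x z
  · rw [fiberSet_eq_panelFiber hxz]
    exact ⟨panelFiber_downClosed hc hxz, hb.panelFiber_twoDownClosed hc hk4 hxz⟩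
  rw [fiberSet_eq_coneFiber hxz]
  rcases hx with (rfl | hzx) | ⟨hxN, y, y', hyy', hzy, hzy', hxy, hxy'⟩
  · rw [coneFiber_self]
    exact ⟨fun _ _ h => h.elim, fun _ _ _ h => h.elim⟩
  · exact absurd (SimpleGraph.Adj.symm hzx) hxz
  · have hne : x ≠ z := fun h => hxN (Or.inl h)
    exact ⟨hb.coneFiber_downClosed hc hk4 hne hxz hyy' hzy hzy' hxy hxy',
      hb.coneFiber_twoDownClosed hc hk4 hne hxz hyy' hzy hzy' hxy hxy'⟩

end Fibers

/-- Every fiber of a star induces an isometric (in particular bridged) subgraph. -/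
theorem stmt9 (G : SimpleGraph V) (hc : G.Connected) (hb : Bridged G) (hk4 : K4Free G)
    (z x : V) (hx : x ∈ starSet G z) :
    (∀ (u : V) (hu : u ∈ fiberSet G z x) (v : V) (hv : v ∈ fiberSet G z x),
      (G.induce (fiberSet G z x)).dist ⟨u, hu⟩ ⟨v, hv⟩ = G.dist u v) ∧
    Bridged (G.induce (fiberSet G z x)) := by
  obtain ⟨hA, hB⟩ := hb.fiberSet_closed hc hk4 hx
  have hF : ∀ (u v : V) (hu : u ∈ fiberSet G z x) (hv : v ∈ fiberSet G z x),
      ∃ w : (G.induce (fiberSet G z x)).Walk ⟨u, hu⟩ ⟨v, hv⟩, w.length = G.dist u v :=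
    fun u v hu hv => hb.exists_walk_induce hc hA hB _ u v hu hv rfl
  exact ⟨fun u hu v hv => dist_induce_eq hF ⟨u, hu⟩ ⟨v, hv⟩, hb.induce hc hF⟩
end
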